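/- Let Ω ⊂ ℝ² be a bounded, open, simply connected domain with smooth boundary and b ∈ (0,1). There exists a constant C > 0, depending only on Ω and b, such that the following holds. Let ε ∈ (0,1] and h_ex > 0 with h_ex·ε ≤ 1; let a : clos(Ω) → ℝ be continuous with b ≤ a ≤ 1; let ρ ∈ C¹(clos(Ω); ℝ) with √b ≤ ρ ≤ 1 satisfy the weak Neumann Euler–Lagrange identity ∫_Ω ∇ρ·∇φ = ε⁻² ∫_Ω ρ(a − ρ²)φ for every Lipschitz φ : clos(Ω) → ℝ; let ξ ∈ C²(clos(Ω); ℝ) satisfy −div(∇ξ/ρ²) + ξ = 1 in Ω and ξ = 0 on ∂Ω, and set A⁰ := −∇⊥ξ/ρ². Suppose (𝐮, 𝐀) = (ρu, A + h_ex A⁰) with 𝐮 ∈ C²(clos(Ω); ℂ) and 𝐀 ∈ C²(clos(Ω); ℝ²) is a classical solution of the Ginzburg–Landau system: −(div − i𝐀·)(∇𝐮 − i𝐀𝐮) = 𝐮(a − |𝐮|²)/ε² in Ω, −∇⊥(curl 𝐀) = ⟨i𝐮, ∇_𝐀 𝐮⟩ in Ω, curl 𝐀 = h_ex on ∂Ω,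 (∇_𝐀 𝐮)·ν = 0 on ∂Ω, with A in the Coulomb gauge (div A = 0 in Ω, A·ν = 0 on ∂Ω), and that GL_ε(𝐮, 𝐀) ≤ GL_ε(ρ, h_ex A⁰). Then F_{ε,ρ}(u, A) ≤ C h_ex². -/

import Mathlib

noncomputable section

open MeasureTheory

/-- The plane ℝ², with its Euclidean structure. -/
abbrev V2 : Type := EuclideanSpace ℝ (Fin 2)

/-- The first standard basis vector of the plane. -/
def ee1 : V2 := EuclideanSpace.single (0 : Fin 2) (1 : ℝ)

/-- The second standard basis vector of the plane. -/
def ee2 : V2 := EuclideanSpace.single (1 : Fin 2) (1 : ℝ)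

/-- First partial derivative. -/
def pd1 {E : Type*} [NormedAddCommGroup E] [NormedSpace ℝ E] (f : V2 → E) (x : V2) : E :=
  fderiv ℝ f x ee1

/-- Second partial derivative. -/
def pd2 {E : Type*} [NormedAddCommGroup E] [NormedSpace ℝ E] (f : V2 → E) (x : V2) : E :=
  fderiv ℝ f x ee2

/-- The vector of ℝ² with the given coordinates. -/
def mkV (a b : ℝ) : V2 := (EuclideanSpace.equiv (Fin 2) ℝ).symm ![a, b]

/-- Squared norm of the gradient of a real-valued function. -/
def gradSq (v : V2 → ℝ) (x : V2) : ℝ := (pd1 v x) ^ 2 + (pd2 v x) ^ 2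

/-- First component of the covariant gradient ∇_A u = ∇u - iAu. -/
def covD1 (u : V2 → ℂ) (A : V2 → V2) (y : V2) : ℂ := pd1 u y - Complex.I * (A y 0 : ℂ) * u y

/-- Second component of the covariant gradient ∇_A u = ∇u - iAu. -/
def covD2 (u : V2 → ℂ) (A : V2 → V2) (y : V2) : ℂ := pd2 u y - Complex.I * (A y 1 : ℂ) * u y

/-- Squared norm of the covariant gradient. -/
def covGradSq (u : V2 → ℂ) (A : V2 → V2) (x : V2) : ℝ :=
  ‖covD1 u A x‖ ^ 2 + ‖covD2 u A x‖ ^ 2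

/-- Curl of a planar vector field. -/
def curl2 (A : V2 → V2) (x : V2) : ℝ :=
  pd1 (fun y => A y 1) x - pd2 (fun y => A y 0) x

/-- Divergence of a planar vector field. -/
def div2 (A : V2 → V2) (x : V2) : ℝ :=
  pd1 (fun y => A y 0) x + pd2 (fun y => A y 1) x

/-- The real scalar product ⟨z,w⟩ = Re (z · conj w) on ℂ. -/
def rin (z w : ℂ) : ℝ := (z * (starRingEnd ℂ) w).re

/-- Superconducting current ⟨iu, ∇_A u⟩. -/
def scurrent (u : V2 → ℂ) (A : V2 → V2) (x : V2) : V2 :=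
  mkV (rin (Complex.I * u x) (covD1 u A x)) (rin (Complex.I * u x) (covD2 u A x))

/-- Vorticity μ(u,A) = curl(⟨iu,∇_A u⟩ + A). -/
def vorticity (u : V2 → ℂ) (A : V2 → V2) (x : V2) : ℝ :=
  curl2 (fun y => scurrent u A y + A y) x

/-- Pinned Ginzburg–Landau energy without magnetic field (real-valued configuration). -/
def Eeps (Ω : Set V2) (a : V2 → ℝ) (ε : ℝ) (v : V2 → ℝ) : ℝ :=
  (1 / 2) * ∫ x in Ω, (gradSq v x + (a x - v x ^ 2) ^ 2 / (2 * ε ^ 2))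

/-- Weighted Ginzburg–Landau free energy F_{ε,ρ}(u,A). -/
def Feps (Ω : Set V2) (ε : ℝ) (ρ : V2 → ℝ) (u : V2 → ℂ) (A : V2 → V2) : ℝ :=
  (1 / 2) * ∫ x in Ω, (ρ x ^ 2 * covGradSq u A x
    + ρ x ^ 4 * (1 - ‖u x‖ ^ 2) ^ 2 / (2 * ε ^ 2) + curl2 A x ^ 2)

/-- Full Ginzburg–Landau energy with pinning and applied field. -/
def GLeps (Ω : Set V2) (a : V2 → ℝ) (ε hex : ℝ) (u : V2 → ℂ) (A : V2 → V2) : ℝ :=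
  (1 / 2) * ∫ x in Ω, (covGradSq u A x + (a x - ‖u x‖ ^ 2) ^ 2 / (2 * ε ^ 2)
    + (curl2 A x - hex) ^ 2)

/-- Weak (Neumann) Euler–Lagrange identity for ρ, tested against Lipschitz functions. -/
def WeakEL (Ω : Set V2) (a : V2 → ℝ) (ε : ℝ) (ρ : V2 → ℝ) : Prop :=
  ∀ φ : V2 → ℝ, (∃ K : NNReal, LipschitzWith K φ) →
    ∫ x in Ω, (pd1 ρ x * pd1 φ x + pd2 ρ x * pd2 φ x)
      = (ε ^ 2)⁻¹ * ∫ x in Ω, ρ x * (a x - ρ x ^ 2) * φ x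

/-- Data witnessing that the open set Ω has smooth boundary:
a global smooth defining function with nonvanishing gradient on the boundary. -/
structure SmoothBdry (Ω : Set V2) where
  f : V2 → ℝ
  smooth : ContDiff ℝ (⊤ : ℕ∞) f
  eq_set : Ω = {x | f x < 0}
  grad_ne : ∀ x ∈ frontier Ω, fderiv ℝ f x ≠ 0

/-- The outward unit normal to ∂Ω computed from a smooth defining function. -/
def SmoothBdry.normal {Ω : Set V2} (sb : SmoothBdry Ω) (x : V2) : V2 :=
  ‖mkV (pd1 sb.f x) (pd2 sb.f x)‖⁻¹ • mkV (pd1 sb.f x) (pd2 sb.f x)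

/-- The first Ginzburg–Landau equation -(div - iA·)(∇_A u) = u(a-|u|²)/ε² in Ω. -/
def GLeq1 (Ω : Set V2) (a : V2 → ℝ) (ε : ℝ) (u : V2 → ℂ) (A : V2 → V2) : Prop :=
  ∀ x ∈ Ω,
    -(pd1 (covD1 u A) x + pd2 (covD2 u A) x
        - Complex.I * ((A x 0 : ℂ) * covD1 u A x + (A x 1 : ℂ) * covD2 u A x))
      = u x * ((a x - ‖u x‖ ^ 2 : ℝ) : ℂ) / (ε : ℂ) ^ 2

/-- The covariant Neumann boundary condition (∇_A u)·ν = 0 on ∂Ω. -/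
def CovNeumann (Ω : Set V2) (sb : SmoothBdry Ω) (u : V2 → ℂ) (A : V2 → V2) : Prop :=
  ∀ x ∈ frontier Ω,
    covD1 u A x * (sb.normal x 0 : ℂ) + covD2 u A x * (sb.normal x 1 : ℂ) = 0

/-- The second Ginzburg–Landau equation -∇⊥(curl A) = ⟨iu, ∇_A u⟩ in Ω. -/
def GLeq2 (Ω : Set V2) (u : V2 → ℂ) (A : V2 → V2) : Prop :=
  ∀ x ∈ Ω,
    pd2 (curl2 A) x = rin (Complex.I * u x) (covD1 u A x) ∧
    -(pd1 (curl2 A) x) = rin (Complex.I * u x) (covD2 u A x)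

/-- Coulomb gauge: div A = 0 in Ω and A·ν = 0 on ∂Ω. -/
def CoulombGauge (Ω : Set V2) (sb : SmoothBdry Ω) (A : V2 → V2) : Prop :=
  (∀ x ∈ Ω, div2 A x = 0) ∧
  (∀ x ∈ frontier Ω, A x 0 * sb.normal x 0 + A x 1 * sb.normal x 1 = 0)

/-- The classical PDE -div(∇ξ/ρ²) + ξ = 1 at points of Ω. -/
def XiPDE (Ω : Set V2) (ρ ξ : V2 → ℝ) : Prop :=
  ∀ x ∈ Ω,
    -(pd1 (fun y => pd1 ξ y / ρ y ^ 2) x + pd2 (fun y => pd2 ξ y / ρ y ^ 2) x) + ξ x = 1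

/-- The Meissner approximation vector potential A⁰ = -∇⊥ξ/ρ². -/
def meissnerA0 (ρ ξ : V2 → ℝ) : V2 → V2 :=
  fun y => mkV (pd2 ξ y / ρ y ^ 2) (-(pd1 ξ y) / ρ y ^ 2)


lemma second_deriv_nonpos_of_right_max {g g' : ℝ → ℝ} {c : ℝ}
    (hg : ∀ t, HasDerivAt g (g' t) t) (h0 : g' 0 = 0) (h2 : HasDerivAt g' c 0)
    (hmax : ∀ᶠ t in nhdsWithin 0 (Set.Ioi 0), g t ≤ g 0) : c ≤ 0 := by
  by_contra! hc
  have h3 : ∀ᶠ t in nhdsWithin (0 : ℝ) (Set.Ioi 0), 0 < g' t := by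
    have h4 := (hasDerivAt_iff_tendsto_slope.1 h2).eventually (lt_mem_nhds hc)
    have h5 : ∀ᶠ t in nhdsWithin (0 : ℝ) (Set.Ioi 0), 0 < slope g' 0 t :=
      h4.filter_mono (nhdsWithin_mono _ fun t ht => (ne_of_gt ht))
    filter_upwards [h5, self_mem_nhdsWithin] with t ht ht0
    have ht0' : (0 : ℝ) < t := ht0
    rw [slope_def_field, h0, sub_zero, sub_zero] at ht
    exact (div_pos_iff_of_pos_right ht0').1 ht
  obtain ⟨d, hd, hd'⟩ := mem_nhdsGT_iff_exists_Ioc_subset.1 (h3.and hmax)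
  have hd0 : (0 : ℝ) < d := hd
  have hmono : StrictMonoOn g (Set.Icc 0 d) := by
    apply strictMonoOn_of_deriv_pos (convex_Icc 0 d)
    · exact fun t _ => (hg t).continuousAt.continuousWithinAt
    · intro t ht
      rw [interior_Icc] at ht
      rw [(hg t).deriv]
      exact (hd' ⟨ht.1, ht.2.le⟩).1
  have h6 := hmono (Set.left_mem_Icc.2 hd0.le) (Set.right_mem_Icc.2 hd0.le) hd0
  have h7 := (hd' ⟨hd0, le_refl d⟩).2
  linarith

lemma hessian_nonpos_of_right_max {w : V2 → ℝ} (hw : ContDiff ℝ 2 w) {x d : V2}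
    (h0 : fderiv ℝ w x = 0)
    (hmax : ∀ᶠ t in nhdsWithin (0 : ℝ) (Set.Ioi 0), w (x + t • d) ≤ w x) :
    fderiv ℝ (fderiv ℝ w) x d d ≤ 0 := by
  have hline : ∀ t : ℝ, HasDerivAt (fun s : ℝ => x + s • d) d t := fun t => by
    simpa using ((hasDerivAt_id t).smul_const d).const_add x
  have hw1 : Differentiable ℝ w := hw.differentiable (by norm_num)
  have hw2 : Differentiable ℝ (fderiv ℝ w) :=
    (hw.fderiv_right (m := 1) (by norm_num)).differentiable (by norm_num)
  refine second_deriv_nonpos_of_right_max (g := fun t => w (x + t • d))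
    (g' := fun t => fderiv ℝ w (x + t • d) d) ?_ ?_ ?_ ?_
  · intro t
    exact (hw1 _).hasFDerivAt.comp_hasDerivAt t (hline t)
  · simp [h0]
  · have h1 : HasFDerivAt (fderiv ℝ w) (fderiv ℝ (fderiv ℝ w) x) (x + (0 : ℝ) • d) := by
      simpa using (hw2 x).hasFDerivAt
    have h2 := h1.comp_hasDerivAt (0 : ℝ) (hline 0)
    simpa using h2.clm_apply (hasDerivAt_const (0 : ℝ) d)
  · simpa using hmax

lemma fderiv_fderiv_apply {w : V2 → ℝ} (hw : ContDiff ℝ 2 w) (x d : V2) :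
    fderiv ℝ (fun y => fderiv ℝ w y d) x d = fderiv ℝ (fderiv ℝ w) x d d := by
  have hw2 : Differentiable ℝ (fderiv ℝ w) :=
    (hw.fderiv_right (m := 1) (by norm_num)).differentiable (by norm_num)
  rw [fderiv_clm_apply (hw2 x) (differentiableAt_const d)]
  simp

lemma clm_ext_ee {E : Type*} [NormedAddCommGroup E] [NormedSpace ℝ E] {l m : V2 →L[ℝ] E}
    (h1 : l ee1 = m ee1) (h2 : l ee2 = m ee2) : l = m := by
  ext v
  have hv : v = v 0 • ee1 + v 1 • ee2 := by
    ext i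
    fin_cases i <;> simp [ee1, ee2]
  rw [hv, map_add, map_add, map_smul, map_smul, map_smul, map_smul, h1, h2]

/-- At a critical point that is a maximum along all directions of an open half plane,
the Laplacian is nonpositive. -/
lemma laplacian_nonpos_of_half_plane_max {w : V2 → ℝ} (hw : ContDiff ℝ 2 w) {x : V2}
    (h0 : fderiv ℝ w x = 0) {l : V2 →L[ℝ] ℝ} (hl : l ≠ 0)
    (hmax : ∀ d, l d < 0 → ∀ᶠ t in nhdsWithin (0 : ℝ) (Set.Ioi 0), w (x + t • d) ≤ w x) :
    pd1 (pd1 w) x + pd2 (pd2 w) x ≤ 0 := by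
  have key : ∀ d, l d ≠ 0 → fderiv ℝ (fderiv ℝ w) x d d ≤ 0 := by
    intro d hd
    rcases lt_or_gt_of_ne hd with h | h
    · exact hessian_nonpos_of_right_max hw h0 (hmax d h)
    · have := hessian_nonpos_of_right_max hw h0 (hmax (-d) (by simpa using h))
      simpa using this
  have e1 : pd1 (pd1 w) x = fderiv ℝ (fderiv ℝ w) x ee1 ee1 := fderiv_fderiv_apply hw x ee1
  have e2 : pd2 (pd2 w) x = fderiv ℝ (fderiv ℝ w) x ee2 ee2 := fderiv_fderiv_apply hw x ee2
  rw [e1, e2]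
  by_cases h : l ee1 ≠ 0 ∧ l ee2 ≠ 0
  · linarith [key _ h.1, key _ h.2]
  · have hne : l ee1 ≠ 0 ∨ l ee2 ≠ 0 := by
      by_contra! h'
      exact hl (clm_ext_ee (by simpa using h'.1) (by simpa using h'.2))
    have hp : l (ee1 + ee2) ≠ 0 ∧ l (ee1 - ee2) ≠ 0 := by
      rw [map_add, map_sub]
      rcases hne with h1 | h1
      · have h2 : l ee2 = 0 := by
          by_contra h2
          exact h ⟨h1, h2⟩
        simp [h1, h2]
      · have h2 : l ee1 = 0 := by
          by_contra h2
          exact h ⟨h2, h1⟩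
        simp [h1, h2]
    have k1 := key _ hp.1
    have k2 := key _ hp.2
    simp only [map_add, map_sub, add_apply, sub_apply]
      at k1 k2
    linarith

lemma laplacian_nonpos_of_isLocalMax {w : V2 → ℝ} (hw : ContDiff ℝ 2 w) {x : V2}
    (hx : IsLocalMax w x) : pd1 (pd1 w) x + pd2 (pd2 w) x ≤ 0 := by
  have hl : (EuclideanSpace.proj (0 : Fin 2) : V2 →L[ℝ] ℝ) ≠ 0 := by
    intro h
    have := congrArg (fun l : V2 →L[ℝ] ℝ => l ee1) h
    simp [ee1] at this
  refine laplacian_nonpos_of_half_plane_max hw hx.fderiv_eq_zero hl fun d _ => ?_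
  have hc : Filter.Tendsto (fun t : ℝ => x + t • d) (nhdsWithin 0 (Set.Ioi 0)) (nhds x) := by
    have : Continuous fun t : ℝ => x + t • d := by fun_prop
    simpa using (this.tendsto 0).mono_left nhdsWithin_le_nhds
  exact hc.eventually hx

lemma contDiff_fderiv_apply {E : Type*} [NormedAddCommGroup E] [NormedSpace ℝ E] {f : V2 → E}
    {m n : WithTop ℕ∞} (hf : ContDiff ℝ n f) (hmn : m + 1 ≤ n) (d : V2) :
    ContDiff ℝ m (fun y => fderiv ℝ f y d) :=
  (hf.fderiv_right hmn).clm_apply contDiff_const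

lemma fderiv_norm_sq_comp_apply {u : V2 → ℂ} {x : V2} (hu : DifferentiableAt ℝ u x) (d : V2) :
    fderiv ℝ (fun y => ‖u y‖ ^ 2) x d = 2 * inner ℝ (u x) (fderiv ℝ u x d) := by
  rw [hu.hasFDerivAt.norm_sq.fderiv]
  simp
  ring

/-- Directional form of the identity `½ ∂²|u|² = |D u|² + ⟨u, D D u⟩` for the covariant
derivative `D = ∂ - iα`. -/
lemma second_fderiv_norm_sq {u : V2 → ℂ} {α : V2 → ℝ} (hu : ContDiff ℝ 2 u)
    (hα : Differentiable ℝ α) (x d : V2) {D : V2 → ℂ}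
    (hD : D = fun y => fderiv ℝ u y d - Complex.I * (α y : ℂ) * u y) :
    fderiv ℝ (fun y => fderiv ℝ (fun z => ‖u z‖ ^ 2) y d) x d
      = 2 * ‖D x‖ ^ 2
        + 2 * ((starRingEnd ℂ) (u x) * (fderiv ℝ D x d - Complex.I * ((α x : ℂ) * D x))).re := by
  have hu1 : Differentiable ℝ u := hu.differentiable (by norm_num)
  have hu2 : Differentiable ℝ (fun y => fderiv ℝ u y d) :=
    (contDiff_fderiv_apply (m := 1) hu (by norm_num) d).differentiable (by norm_num)
  have e1 : (fun y => fderiv ℝ (fun z => ‖u z‖ ^ 2) y d)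
      = fun y => 2 * inner ℝ (u y) (fderiv ℝ u y d) :=
    funext fun y => fderiv_norm_sq_comp_apply (hu1 y) d
  have e2 : fderiv ℝ (fun y => 2 * inner ℝ (u y) (fderiv ℝ u y d)) x d
      = 2 * (inner ℝ (u x) (fderiv ℝ (fun y => fderiv ℝ u y d) x d)
        + inner ℝ (fderiv ℝ u x d) (fderiv ℝ u x d)) := by
    rw [fderiv_const_mul ((hu1 x).inner ℝ (hu2 x)), smul_apply,
      fderiv_inner_apply ℝ (hu1 x) (hu2 x), smul_eq_mul]
  have e3 : fderiv ℝ D x d = fderiv ℝ (fun y => fderiv ℝ u y d) x d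
      - Complex.I * ((fderiv ℝ α x d : ℂ) * u x + (α x : ℂ) * fderiv ℝ u x d) := by
    have h1 : HasFDerivAt (fun y => (α y : ℂ)) (Complex.ofRealCLM.comp (fderiv ℝ α x)) x :=
      Complex.ofRealCLM.hasFDerivAt.comp x (hα x).hasFDerivAt
    have h2 := (hu2 x).hasFDerivAt.sub ((h1.const_mul Complex.I).mul (hu1 x).hasFDerivAt)
    rw [hD]
    have h3 := h2.fderiv
    erw [h3]
    simp
    ring
  rw [e1, e2, e3, hD]
  dsimp only
  generalize fderiv ℝ (fun y => fderiv ℝ u y d) x d = u2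
  generalize fderiv ℝ u x d = u1
  generalize fderiv ℝ α x d = α1
  rw [← Complex.normSq_eq_norm_sq]
  simp only [Complex.inner, Complex.normSq_apply, Complex.mul_re, Complex.mul_im, Complex.sub_re,
    Complex.sub_im, Complex.add_re, Complex.add_im, Complex.conj_re, Complex.conj_im,
    Complex.I_re, Complex.I_im, Complex.ofReal_re, Complex.ofReal_im]
  ring

lemma differentiable_coord {A : V2 → V2} (hA : Differentiable ℝ A) (i : Fin 2) :
    Differentiable ℝ (fun y => A y i) :=
  (EuclideanSpace.proj i : V2 →L[ℝ] ℝ).differentiable.comp hA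

lemma laplacian_norm_sq {Ω : Set V2} {a : V2 → ℝ} {ε : ℝ} {u : V2 → ℂ} {A : V2 → V2}
    (hu : ContDiff ℝ 2 u) (hA : ContDiff ℝ 2 A) (h : GLeq1 Ω a ε u A) {x : V2} (hx : x ∈ Ω) :
    pd1 (pd1 fun y => ‖u y‖ ^ 2) x + pd2 (pd2 fun y => ‖u y‖ ^ 2) x
      = 2 * covGradSq u A x - 2 * ‖u x‖ ^ 2 * (a x - ‖u x‖ ^ 2) / ε ^ 2 := by
  have hA1 := hA.differentiable (by norm_num)
  have k1 : pd1 (pd1 fun y => ‖u y‖ ^ 2) x = _ :=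
    second_fderiv_norm_sq hu (differentiable_coord hA1 0) x ee1 (D := covD1 u A) rfl
  have k2 : pd2 (pd2 fun y => ‖u y‖ ^ 2) x = _ :=
    second_fderiv_norm_sq hu (differentiable_coord hA1 1) x ee2 (D := covD2 u A) rfl
  have hE := h x hx
  have e : (starRingEnd ℂ) (u x) * (fderiv ℝ (covD1 u A) x ee1
        - Complex.I * ((A x 0 : ℂ) * covD1 u A x))
      + (starRingEnd ℂ) (u x) * (fderiv ℝ (covD2 u A) x ee2
        - Complex.I * ((A x 1 : ℂ) * covD2 u A x))
      = ((-(‖u x‖ ^ 2 * (a x - ‖u x‖ ^ 2) / ε ^ 2) : ℝ) : ℂ) := by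
    have hn : (starRingEnd ℂ) (u x) * u x = ((‖u x‖ ^ 2 : ℝ) : ℂ) := by
      rw [mul_comm, Complex.mul_conj, Complex.normSq_eq_norm_sq]
    have hE' : fderiv ℝ (covD1 u A) x ee1 + fderiv ℝ (covD2 u A) x ee2
        - Complex.I * ((A x 0 : ℂ) * covD1 u A x + (A x 1 : ℂ) * covD2 u A x)
        = -(u x * ((a x - ‖u x‖ ^ 2 : ℝ) : ℂ) / (ε : ℂ) ^ 2) := by
      rw [← hE, neg_neg]
      rfl
    calc _ = (starRingEnd ℂ) (u x) * (fderiv ℝ (covD1 u A) x ee1 + fderiv ℝ (covD2 u A) x ee2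
        - Complex.I * ((A x 0 : ℂ) * covD1 u A x + (A x 1 : ℂ) * covD2 u A x)) := by ring
      _ = -(((starRingEnd ℂ) (u x) * u x) * ((a x - ‖u x‖ ^ 2 : ℝ) : ℂ) / (ε : ℂ) ^ 2) := by
        rw [hE']
        ring
      _ = _ := by
        rw [hn]
        push_cast
        ring
  have e' := congrArg Complex.re e
  rw [Complex.add_re, Complex.ofReal_re] at e'
  rw [k1, k2, covGradSq]
  linear_combination 2 * e'

lemma SmoothBdry.eventually_mem {Ω : Set V2} (sb : SmoothBdry Ω) {x : V2} (hx : sb.f x ≤ 0)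
    {d : V2} (hd : fderiv ℝ sb.f x d < 0) :
    ∀ᶠ t in nhdsWithin (0 : ℝ) (Set.Ioi 0), x + t • d ∈ Ω := by
  have hline : HasDerivAt (fun s : ℝ => x + s • d) d 0 := by
    simpa using ((hasDerivAt_id (0 : ℝ)).smul_const d).const_add x
  have hf : HasFDerivAt sb.f (fderiv ℝ sb.f x) (x + (0 : ℝ) • d) := by
    simpa using (sb.smooth.differentiable (by simp) x).hasFDerivAt
  have h1 := hf.comp_hasDerivAt (0 : ℝ) hline
  have h2 := (hasDerivAt_iff_tendsto_slope.1 h1).eventually (gt_mem_nhds hd)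
  have h3 : ∀ᶠ t in nhdsWithin (0 : ℝ) (Set.Ioi 0),
      slope (sb.f ∘ fun s : ℝ => x + s • d) 0 t < 0 :=
    h2.filter_mono (nhdsWithin_mono _ fun t ht => (ne_of_gt ht))
  filter_upwards [h3, self_mem_nhdsWithin] with t ht ht0
  have ht0' : (0 : ℝ) < t := ht0
  rw [slope_def_field, sub_zero] at ht
  replace ht := (div_lt_iff₀ ht0').1 ht
  rw [zero_mul] at ht
  simp only [Function.comp_apply, zero_smul, add_zero] at ht
  rw [sb.eq_set]
  change sb.f _ < 0
  linarith

lemma mkV_eq (a b : ℝ) : mkV a b = a • ee1 + b • ee2 := by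
  ext i
  fin_cases i <;> simp [mkV, ee1, ee2]

@[simp] lemma mkV_zero (a b : ℝ) : mkV a b 0 = a := by simp [mkV]

@[simp] lemma mkV_one (a b : ℝ) : mkV a b 1 = b := by simp [mkV]

/-- Maximum principle for the first Ginzburg-Landau equation. -/
lemma norm_sq_le_one {Ω : Set V2} (hΩo : IsOpen Ω) (hΩb : Bornology.IsBounded Ω)
    (sb : SmoothBdry Ω) {a : V2 → ℝ} {ε : ℝ} (hε : 0 < ε) (ha : ∀ x ∈ closure Ω, a x ≤ 1)
    {u : V2 → ℂ} {A : V2 → V2} (hu : ContDiff ℝ 2 u) (hA : ContDiff ℝ 2 A)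
    (h : GLeq1 Ω a ε u A) (hN : CovNeumann Ω sb u A) :
    ∀ x ∈ closure Ω, ‖u x‖ ^ 2 ≤ 1 := by
  intro y hy
  have hw : ContDiff ℝ 2 (fun y => ‖u y‖ ^ 2) := hu.norm_sq ℝ
  have hu1 : Differentiable ℝ u := hu.differentiable (by norm_num)
  have hlap : Continuous fun x =>
      pd1 (pd1 fun y => ‖u y‖ ^ 2) x + pd2 (pd2 fun y => ‖u y‖ ^ 2) x :=
    (contDiff_fderiv_apply (m := 0) (contDiff_fderiv_apply (m := 1) hw (by norm_num) ee1)
      (by norm_num) ee1).continuous.add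
    (contDiff_fderiv_apply (m := 0) (contDiff_fderiv_apply (m := 1) hw (by norm_num) ee2)
      (by norm_num) ee2).continuous
  have hsub : closure Ω ⊆ {x | 2 * ‖u x‖ ^ 2 * (‖u x‖ ^ 2 - 1) / ε ^ 2
      ≤ pd1 (pd1 fun y => ‖u y‖ ^ 2) x + pd2 (pd2 fun y => ‖u y‖ ^ 2) x} := by
    refine closure_minimal ?_ (isClosed_le ?_ hlap)
    · intro x hx
      rw [Set.mem_ofPred_eq, laplacian_norm_sq hu hA h hx]
      have h1 : 0 ≤ covGradSq u A x := by
        unfold covGradSq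
        positivity
      have h2 := ha x (subset_closure hx)
      have h3 : 2 * ‖u x‖ ^ 2 * (‖u x‖ ^ 2 - 1) / ε ^ 2
          ≤ -(2 * ‖u x‖ ^ 2 * (a x - ‖u x‖ ^ 2) / ε ^ 2) := by
        rw [← neg_div]
        apply div_le_div_of_nonneg_right _ (by positivity)
        nlinarith [sq_nonneg ‖u x‖]
      linarith
    · have := hu.continuous
      fun_prop
  obtain ⟨x, hx, hmax⟩ := hΩb.isCompact_closure.exists_isMaxOn ⟨y, hy⟩ hw.continuous.continuousOn
  refine (hmax hy).trans ?_
  by_contra! hgt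
  have hgt' : 1 < ‖u x‖ ^ 2 := hgt
  have hpos : 0 < pd1 (pd1 fun y => ‖u y‖ ^ 2) x + pd2 (pd2 fun y => ‖u y‖ ^ 2) x := by
    refine lt_of_lt_of_le ?_ (hsub hx)
    have : 0 < ‖u x‖ ^ 2 - 1 := by linarith
    have : 0 < ‖u x‖ ^ 2 := by linarith
    positivity
  by_cases hxΩ : x ∈ Ω
  · have hloc : IsLocalMax (fun y => ‖u y‖ ^ 2) x := by
      filter_upwards [hΩo.mem_nhds hxΩ] with z hz
      exact hmax (subset_closure hz)
    linarith [laplacian_nonpos_of_isLocalMax hw hloc]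
  have hfr : x ∈ frontier Ω := ⟨hx, by rwa [hΩo.interior_eq]⟩
  have hfx : sb.f x ≤ 0 := by
    have : closure Ω ⊆ {x | sb.f x ≤ 0} := by
      refine closure_minimal ?_ (isClosed_le sb.smooth.continuous continuous_const)
      intro z hz
      rw [sb.eq_set] at hz
      exact le_of_lt (show sb.f z < 0 from hz)
    exact this hx
  have hdir : ∀ d, fderiv ℝ sb.f x d < 0 → ∀ᶠ t in nhdsWithin (0 : ℝ) (Set.Ioi 0),
      ‖u (x + t • d)‖ ^ 2 ≤ ‖u x‖ ^ 2 := by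
    intro d hd
    filter_upwards [sb.eventually_mem hfx hd] with t ht
    exact hmax (subset_closure ht)
  set n : V2 := mkV (pd1 sb.f x) (pd2 sb.f x) with hn
  have hln : fderiv ℝ sb.f x n = pd1 sb.f x ^ 2 + pd2 sb.f x ^ 2 := by
    rw [hn, mkV_eq, map_add, map_smul, map_smul]
    simp only [pd1, pd2, smul_eq_mul]
    ring
  have hlpos : 0 < fderiv ℝ sb.f x n := by
    rw [hln]
    by_contra! hle
    apply sb.grad_ne x hfr
    have h1 : pd1 sb.f x = 0 := by nlinarith [sq_nonneg (pd1 sb.f x), sq_nonneg (pd2 sb.f x)]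
    have h2 : pd2 sb.f x = 0 := by nlinarith [sq_nonneg (pd1 sb.f x), sq_nonneg (pd2 sb.f x)]
    exact clm_ext_ee (by simpa [pd1] using h1) (by simpa [pd2] using h2)
  have hn0 : n ≠ 0 := by
    intro h0
    rw [h0, map_zero] at hlpos
    exact lt_irrefl _ hlpos
  have hNx : covD1 u A x * ((pd1 sb.f x : ℝ) : ℂ) + covD2 u A x * ((pd2 sb.f x : ℝ) : ℂ) = 0 := by
    have h1 := hN x hfr
    have hnn : ((‖n‖ : ℝ) : ℂ) ≠ 0 := by
      exact_mod_cast norm_ne_zero_iff.2 hn0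
    simp only [SmoothBdry.normal, ← hn, PiLp.smul_apply, smul_eq_mul, Complex.ofReal_mul,
      Complex.ofReal_inv] at h1
    rw [hn] at h1
    simp only [mkV_zero, mkV_one] at h1
    rw [← hn] at h1
    field_simp at h1
    linear_combination h1
  have hgn : fderiv ℝ (fun y => ‖u y‖ ^ 2) x n = 0 := by
    rw [fderiv_norm_sq_comp_apply (hu1 x), hn, mkV_eq, map_add, map_smul, map_smul]
    have h1 : fderiv ℝ u x ee1 = covD1 u A x + Complex.I * (A x 0 : ℂ) * u x := by
      simp [covD1, pd1]
    have h2 : fderiv ℝ u x ee2 = covD2 u A x + Complex.I * (A x 1 : ℂ) * u x := by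
      simp [covD2, pd2]
    have h3 : pd1 sb.f x • fderiv ℝ u x ee1 + pd2 sb.f x • fderiv ℝ u x ee2
        = Complex.I * ((A x 0 * pd1 sb.f x + A x 1 * pd2 sb.f x : ℝ) : ℂ) * u x := by
      rw [h1, h2, Complex.real_smul, Complex.real_smul]
      push_cast
      linear_combination hNx
    rw [h3, Complex.inner]
    simp only [Complex.mul_re, Complex.mul_im, Complex.conj_re, Complex.conj_im,
      Complex.I_re, Complex.I_im, Complex.ofReal_re, Complex.ofReal_im]
    ring
  have hg : ∀ d, fderiv ℝ sb.f x d < 0 → fderiv ℝ (fun y => ‖u y‖ ^ 2) x d ≤ 0 := by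
    intro d hd
    by_contra! hc
    have hline : HasDerivAt (fun s : ℝ => x + s • d) d 0 := by
      simpa using ((hasDerivAt_id (0 : ℝ)).smul_const d).const_add x
    have hf : HasFDerivAt (fun y => ‖u y‖ ^ 2) (fderiv ℝ (fun y => ‖u y‖ ^ 2) x)
        (x + (0 : ℝ) • d) := by
      simpa using (hw.differentiable (by norm_num) x).hasFDerivAt
    have h1 := hf.comp_hasDerivAt (0 : ℝ) hline
    have h2 := (hasDerivAt_iff_tendsto_slope.1 h1).eventually (lt_mem_nhds hc)
    have h3 := h2.filter_mono
      (nhdsWithin_mono _ fun t (ht : t ∈ Set.Ioi (0 : ℝ)) => (ne_of_gt ht))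
    obtain ⟨t, ⟨ht, ht1⟩, ht0⟩ := ((h3.and (hdir d hd)).and self_mem_nhdsWithin).exists
    have ht0' : (0 : ℝ) < t := ht0
    rw [slope_def_field, sub_zero, div_pos_iff_of_pos_right ht0'] at ht
    simp only [Function.comp_apply, zero_smul, add_zero] at ht
    linarith
  have hg' : ∀ d, fderiv ℝ (fun y => ‖u y‖ ^ 2) x d ≤ 0 := by
    intro d
    have h1 := hg (d - ((fderiv ℝ sb.f x d + 1) / fderiv ℝ sb.f x n) • n) (by
      rw [map_sub, map_smul, smul_eq_mul, div_mul_cancel₀ _ hlpos.ne']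
      linarith)
    rwa [map_sub, map_smul, hgn, smul_zero, sub_zero] at h1
  have hg0 : fderiv ℝ (fun y => ‖u y‖ ^ 2) x = 0 := by
    ext d
    have h1 := hg' (-d)
    rw [map_neg] at h1
    exact le_antisymm (hg' d) (neg_nonpos.1 h1)
  linarith [laplacian_nonpos_of_half_plane_max hw hg0 (sb.grad_ne x hfr) hdir]

lemma fderiv_div_sq_apply {p r : V2 → ℝ} {x : V2} (hp : DifferentiableAt ℝ p x)
    (hr : DifferentiableAt ℝ r x) (h0 : r x ≠ 0) (d : V2) :
    fderiv ℝ (fun y => p y / r y ^ 2) x d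
      = fderiv ℝ p x d / r x ^ 2 - 2 * p x * fderiv ℝ r x d / r x ^ 3 := by
  have hinv : HasDerivAt (fun t : ℝ => (t ^ 2)⁻¹) (-(2 * r x) / (r x ^ 2) ^ 2) (r x) := by
    simpa using (hasDerivAt_pow 2 (r x)).fun_inv (pow_ne_zero 2 h0)
  have h1 := hp.hasFDerivAt.fun_mul (hinv.comp_hasFDerivAt x hr.hasFDerivAt)
  have h2 : (fun y => p y / r y ^ 2) = fun y => p y * ((fun t : ℝ => (t ^ 2)⁻¹) ∘ r) y := rfl
  rw [h2, h1.fderiv]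
  simp
  field_simp
  ring

lemma xi_eq_of_isLocalExtr {Ω : Set V2} {ρ ξ : V2 → ℝ} (hρ : ContDiff ℝ 1 ρ)
    (hξ : ContDiff ℝ 2 ξ) (hpde : XiPDE Ω ρ ξ) {x : V2} (hx : x ∈ Ω) (hpos : 0 < ρ x)
    (hext : IsLocalExtr ξ x) :
    ξ x = 1 + (pd1 (pd1 ξ) x + pd2 (pd2 ξ) x) / ρ x ^ 2 := by
  have h0 : fderiv ℝ ξ x = 0 := hext.fderiv_eq_zero
  have hd : ∀ d, Differentiable ℝ (fun y => fderiv ℝ ξ y d) := fun d =>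
    (contDiff_fderiv_apply (m := 1) hξ (by norm_num) d).differentiable (by norm_num)
  have hρ1 := hρ.differentiable (by norm_num)
  have k1 : pd1 (fun y => pd1 ξ y / ρ y ^ 2) x = _ :=
    fderiv_div_sq_apply (hd ee1 x) (hρ1 x) hpos.ne' ee1
  have k2 : pd2 (fun y => pd2 ξ y / ρ y ^ 2) x = _ :=
    fderiv_div_sq_apply (hd ee2 x) (hρ1 x) hpos.ne' ee2
  have h := hpde x hx
  rw [k1, k2] at h
  simp only [h0, zero_apply, mul_zero, zero_mul, zero_div, sub_zero] at h
  have e1 : pd1 (pd1 ξ) x = fderiv ℝ (fun y => fderiv ℝ ξ y ee1) x ee1 := rfl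
  have e2 : pd2 (pd2 ξ) x = fderiv ℝ (fun y => fderiv ℝ ξ y ee2) x ee2 := rfl
  rw [e1, e2, add_div]
  linarith

lemma xi_le_one {Ω : Set V2} (hΩo : IsOpen Ω) (hΩb : Bornology.IsBounded Ω) {ρ ξ : V2 → ℝ}
    (hρ : ContDiff ℝ 1 ρ) (hpos : ∀ x ∈ closure Ω, 0 < ρ x) (hξ : ContDiff ℝ 2 ξ)
    (hpde : XiPDE Ω ρ ξ) (h0 : ∀ x ∈ frontier Ω, ξ x = 0) {y : V2} (hy : y ∈ Ω) : ξ y ≤ 1 := by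
  obtain ⟨x, hx, hmax⟩ := hΩb.isCompact_closure.exists_isMaxOn ⟨y, subset_closure hy⟩
    hξ.continuous.continuousOn
  refine (hmax (subset_closure hy)).trans ?_
  by_cases hxΩ : x ∈ Ω
  · have hloc : IsLocalMax ξ x := by
      filter_upwards [hΩo.mem_nhds hxΩ] with z hz
      exact hmax (subset_closure hz)
    have h1 := laplacian_nonpos_of_isLocalMax hξ hloc
    rw [xi_eq_of_isLocalExtr hρ hξ hpde hxΩ (hpos x hx) (Or.inr hloc)]
    linarith [div_nonpos_of_nonpos_of_nonneg h1 (sq_nonneg (ρ x))]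
  · rw [h0 x ⟨hx, by rwa [hΩo.interior_eq]⟩]
    exact zero_le_one

lemma xi_pos {Ω : Set V2} (hΩo : IsOpen Ω) (hΩb : Bornology.IsBounded Ω) {ρ ξ : V2 → ℝ}
    (hρ : ContDiff ℝ 1 ρ) (hpos : ∀ x ∈ closure Ω, 0 < ρ x) (hξ : ContDiff ℝ 2 ξ)
    (hpde : XiPDE Ω ρ ξ) (h0 : ∀ x ∈ frontier Ω, ξ x = 0) {y : V2} (hy : y ∈ Ω) : 0 < ξ y := by
  have key : ∀ z ∈ Ω, IsLocalMin ξ z → 1 ≤ ξ z := by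
    intro z hz hloc
    have h1 := laplacian_nonpos_of_isLocalMax hξ.neg hloc.neg
    have e : ∀ d, fderiv ℝ (fun y => fderiv ℝ (-ξ) y d) z d
        = -fderiv ℝ (fun y => fderiv ℝ ξ y d) z d := by
      intro d
      have : (fun y => fderiv ℝ (-ξ) y d) = -(fun y => fderiv ℝ ξ y d) := by
        ext y
        simp [fderiv_neg]
      rw [this, fderiv_neg]
      rfl
    have e1 : pd1 (pd1 (-ξ)) z = -pd1 (pd1 ξ) z := e ee1
    have e2 : pd2 (pd2 (-ξ)) z = -pd2 (pd2 ξ) z := e ee2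
    have h2 : 0 ≤ pd1 (pd1 ξ) z + pd2 (pd2 ξ) z := by
      change pd1 (pd1 (-ξ)) z + pd2 (pd2 (-ξ)) z ≤ 0 at h1
      linarith
    rw [xi_eq_of_isLocalExtr hρ hξ hpde hz (hpos z (subset_closure hz)) (Or.inl hloc)]
    linarith [div_nonneg h2 (sq_nonneg (ρ z))]
  obtain ⟨x, hx, hmin⟩ := hΩb.isCompact_closure.exists_isMinOn ⟨y, subset_closure hy⟩
    hξ.continuous.continuousOn
  have hxy : ξ x ≤ ξ y := hmin (subset_closure hy)
  by_contra! hle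
  by_cases hxΩ : x ∈ Ω
  · have hloc : IsLocalMin ξ x := by
      filter_upwards [hΩo.mem_nhds hxΩ] with z hz
      exact hmin (subset_closure hz)
    linarith [key x hxΩ hloc]
  · have hx0 := h0 x ⟨hx, by rwa [hΩo.interior_eq]⟩
    have hloc : IsLocalMin ξ y := by
      filter_upwards [hΩo.mem_nhds hy] with z hz
      have h3 : ξ x ≤ ξ z := hmin (subset_closure hz)
      linarith
    linarith [key y hy hloc]

lemma integral_fderiv_apply_eq_zero {F : V2 → ℝ} (hF : ContDiff ℝ 1 F)
    (hc : HasCompactSupport F) (d : V2) : ∫ x, fderiv ℝ F x d = 0 := by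
  have hd : Integrable (fun x => fderiv ℝ F x d) :=
    (contDiff_fderiv_apply (m := 0) hF (by norm_num) d).continuous.integrable_of_hasCompactSupport
      (hc.fderiv_apply ℝ d)
  have h := integral_mul_fderiv_eq_neg_fderiv_mul_of_integrable (μ := (volume : Measure V2))
    (f := fun _ : V2 => (1 : ℝ)) (g := F) (v := d) (by simp) (by simpa using hd)
    (by simpa using hF.continuous.integrable_of_hasCompactSupport hc)
    (fun x _ => differentiableAt_const _) (fun x _ => hF.differentiable (by norm_num) x)
  simpa using h

lemma indicator_eventuallyEq_zero {Ω K : Set V2} (hK : IsClosed K) {g : V2 → ℝ}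
    (h0 : ∀ x ∈ Ω, x ∉ K → g x = 0) {x : V2} (hx : x ∉ K) :
    Ω.indicator g =ᶠ[nhds x] fun _ => 0 := by
  filter_upwards [hK.isOpen_compl.mem_nhds hx] with z hz
  by_cases hzΩ : z ∈ Ω
  · rw [Set.indicator_of_mem hzΩ, h0 z hzΩ hz]
  · rw [Set.indicator_of_notMem hzΩ]

lemma contDiff_indicator {Ω K : Set V2} (hΩo : IsOpen Ω) (hK : IsClosed K) (hKΩ : K ⊆ Ω)
    {g : V2 → ℝ} (hg : ∀ x ∈ Ω, ContDiffAt ℝ 1 g x) (h0 : ∀ x ∈ Ω, x ∉ K → g x = 0) :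
    ContDiff ℝ 1 (Ω.indicator g) := by
  rw [contDiff_iff_contDiffAt]
  intro x
  by_cases hx : x ∈ Ω
  · refine (hg x hx).congr_of_eventuallyEq ?_
    filter_upwards [hΩo.mem_nhds hx] with z hz
    rw [Set.indicator_of_mem hz]
  · exact contDiffAt_const.congr_of_eventuallyEq
      (indicator_eventuallyEq_zero hK h0 fun h => hx (hKΩ h))

lemma setIntegral_fderiv_apply_eq_zero {Ω K : Set V2} (hΩo : IsOpen Ω) (hK : IsCompact K)
    (hKΩ : K ⊆ Ω) {g : V2 → ℝ} (hg : ∀ x ∈ Ω, ContDiffAt ℝ 1 g x)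
    (h0 : ∀ x ∈ Ω, x ∉ K → g x = 0) (d : V2) :
    IntegrableOn (fun x => fderiv ℝ g x d) Ω ∧ ∫ x in Ω, fderiv ℝ g x d = 0 := by
  have hF := contDiff_indicator hΩo hK.isClosed hKΩ hg h0
  have hc : HasCompactSupport (Ω.indicator g) := by
    refine HasCompactSupport.intro hK fun x hx => ?_
    exact (indicator_eventuallyEq_zero hK.isClosed h0 hx).eq_of_nhds
  have heq : ∀ x ∈ Ω, fderiv ℝ (Ω.indicator g) x d = fderiv ℝ g x d := by
    intro x hx
    have : Ω.indicator g =ᶠ[nhds x] g := by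
      filter_upwards [hΩo.mem_nhds hx] with z hz
      rw [Set.indicator_of_mem hz]
    rw [this.fderiv_eq]
  have hint : Integrable (fun x => fderiv ℝ (Ω.indicator g) x d) :=
    (contDiff_fderiv_apply (m := 0) hF (by norm_num) d).continuous.integrable_of_hasCompactSupport
      (hc.fderiv_apply ℝ d)
  refine ⟨hint.integrableOn.congr_fun heq hΩo.measurableSet, ?_⟩
  rw [← setIntegral_congr_fun hΩo.measurableSet heq,
    setIntegral_eq_integral_of_forall_compl_eq_zero, integral_fderiv_apply_eq_zero hF hc]
  intro x hx
  rw [(indicator_eventuallyEq_zero hK.isClosed h0 fun h => hx (hKΩ h)).fderiv_eq]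
  simp

/-- A continuous cutoff vanishing for `s ≤ δ` and equal to one for `2δ ≤ s`. -/
def ramp (δ s : ℝ) : ℝ := max 0 (min 1 ((s - δ) / δ))

lemma continuous_ramp (δ : ℝ) : Continuous (ramp δ) := by
  unfold ramp
  fun_prop

lemma ramp_nonneg (δ s : ℝ) : 0 ≤ ramp δ s := le_max_left _ _

lemma ramp_le_one (δ s : ℝ) : ramp δ s ≤ 1 := max_le zero_le_one (min_le_left _ _)

lemma ramp_eq_zero {δ s : ℝ} (hδ : 0 < δ) (hs : s ≤ δ) : ramp δ s = 0 :=
  max_eq_left ((min_le_right _ _).trans (div_nonpos_of_nonpos_of_nonneg (by linarith) hδ.le))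

lemma ramp_eq_one {δ s : ℝ} (hδ : 0 < δ) (hs : 2 * δ ≤ s) : ramp δ s = 1 := by
  have : 1 ≤ (s - δ) / δ := by
    rw [le_div_iff₀ hδ]
    linarith
  rw [ramp, min_eq_left this, max_eq_right zero_le_one]

/-- The primitive of `ramp`. -/
def rampPrim (δ t : ℝ) : ℝ := ∫ s in (0 : ℝ)..t, ramp δ s

lemma hasDerivAt_rampPrim (δ t : ℝ) : HasDerivAt (rampPrim δ) (ramp δ t) t :=
  intervalIntegral.integral_hasDerivAt_right ((continuous_ramp δ).intervalIntegrable _ _)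
    (continuous_ramp δ).aestronglyMeasurable.stronglyMeasurableAtFilter
    (continuous_ramp δ).continuousAt

lemma contDiff_rampPrim (δ : ℝ) : ContDiff ℝ 1 (rampPrim δ) := by
  rw [contDiff_one_iff_deriv]
  refine ⟨fun t => (hasDerivAt_rampPrim δ t).differentiableAt, ?_⟩
  rw [funext fun t => (hasDerivAt_rampPrim δ t).deriv]
  exact continuous_ramp δ

lemma rampPrim_eq_zero {δ t : ℝ} (hδ : 0 < δ) (ht : t ≤ δ) : rampPrim δ t = 0 := by
  unfold rampPrim
  rw [intervalIntegral.integral_congr (g := fun _ => (0 : ℝ)), intervalIntegral.integral_zero]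
  intro s hs
  have : s ≤ max 0 t := hs.2
  exact ramp_eq_zero hδ (this.trans (max_le hδ.le ht))

lemma rampPrim_le {δ t : ℝ} (ht : 0 ≤ t) : rampPrim δ t ≤ t := by
  calc rampPrim δ t ≤ ∫ _ in (0 : ℝ)..t, (1 : ℝ) :=
        intervalIntegral.integral_mono_on ht ((continuous_ramp δ).intervalIntegrable _ _)
          (by simp) fun s _ => ramp_le_one δ s
    _ = t := by simp

lemma rampPrim_nonneg {δ t : ℝ} (ht : 0 ≤ t) : 0 ≤ rampPrim δ t :=
  intervalIntegral.integral_nonneg ht fun s _ => ramp_nonneg δ s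

lemma integrableOn_of_continuousOn_closure {Ω : Set V2} (hΩb : Bornology.IsBounded Ω)
    {f : V2 → ℝ} (hf : ContinuousOn f (closure Ω)) : IntegrableOn f Ω :=
  (hf.integrableOn_compact hΩb.isCompact_closure).mono_set subset_closure

lemma continuousOn_gradSq_div {Ω : Set V2} {ρ ξ : V2 → ℝ}
    (hρ : ContDiff ℝ 1 ρ) (hpos : ∀ x ∈ closure Ω, 0 < ρ x) (hξ : ContDiff ℝ 2 ξ) :
    ContinuousOn (fun x => gradSq ξ x / ρ x ^ 2) (closure Ω) := by
  have h1 : Continuous (gradSq ξ) :=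
    ((contDiff_fderiv_apply (m := 0) hξ (by norm_num) ee1).continuous.pow 2).add
      ((contDiff_fderiv_apply (m := 0) hξ (by norm_num) ee2).continuous.pow 2)
  exact h1.continuousOn.div (hρ.continuous.pow 2).continuousOn
    fun x hx => pow_ne_zero 2 (hpos x hx).ne'

lemma setIntegral_ramp_mul_le {Ω : Set V2} (hΩo : IsOpen Ω) (hΩb : Bornology.IsBounded Ω)
    {ρ ξ : V2 → ℝ} (hρ : ContDiff ℝ 1 ρ) (hpos : ∀ x ∈ closure Ω, 0 < ρ x)
    (hξ : ContDiff ℝ 2 ξ) (hpde : XiPDE Ω ρ ξ) (h0 : ∀ x ∈ frontier Ω, ξ x = 0)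
    {δ : ℝ} (hδ : 0 < δ) :
    ∫ x in Ω, ramp δ (ξ x) * (gradSq ξ x / ρ x ^ 2) ≤ volume.real Ω := by
  set K : Set V2 := closure Ω ∩ {x | δ ≤ ξ x} with hKdef
  have hK : IsCompact K :=
    hΩb.isCompact_closure.inter_right (isClosed_le continuous_const hξ.continuous)
  have hKΩ : K ⊆ Ω := by
    rintro x ⟨hx, hx'⟩
    by_contra hxΩ
    have h1 := h0 x ⟨hx, by rwa [hΩo.interior_eq]⟩
    have h2 : δ ≤ ξ x := hx'
    linarith
  have hfd : ∀ d, ContDiff ℝ 1 (fun y => fderiv ℝ ξ y d) := fun d =>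
    contDiff_fderiv_apply (m := 1) hξ (by norm_num) d
  have hρ0 : ∀ x ∈ Ω, ρ x ^ 2 ≠ 0 := fun x hx => pow_ne_zero 2 (hpos x (subset_closure hx)).ne'
  have hq : ∀ d, ∀ x ∈ Ω, ContDiffAt ℝ 1 (fun y => fderiv ℝ ξ y d / ρ y ^ 2) x :=
    fun d x hx => (hfd d).contDiffAt.div (hρ.pow 2).contDiffAt (hρ0 x hx)
  have hΦ : ContDiff ℝ 1 (fun y => rampPrim δ (ξ y)) :=
    (contDiff_rampPrim δ).comp (hξ.of_le (by norm_num))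
  have hg : ∀ d, ∀ x ∈ Ω,
      ContDiffAt ℝ 1 (fun y => rampPrim δ (ξ y) * (fderiv ℝ ξ y d / ρ y ^ 2)) x :=
    fun d x hx => hΦ.contDiffAt.mul (hq d x hx)
  have hz : ∀ d, ∀ x ∈ Ω, x ∉ K → rampPrim δ (ξ x) * (fderiv ℝ ξ x d / ρ x ^ 2) = 0 := by
    intro d x hx hxK
    have h1 : ξ x < δ := by
      by_contra! h
      exact hxK ⟨subset_closure hx, h⟩
    rw [rampPrim_eq_zero hδ h1.le, zero_mul]
  have hder : ∀ d, ∀ x ∈ Ω,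
      fderiv ℝ (fun y => rampPrim δ (ξ y) * (fderiv ℝ ξ y d / ρ y ^ 2)) x d
        = ramp δ (ξ x) * (fderiv ℝ ξ x d ^ 2 / ρ x ^ 2)
          + rampPrim δ (ξ x) * fderiv ℝ (fun y => fderiv ℝ ξ y d / ρ y ^ 2) x d := by
    intro d x hx
    have h1 : HasFDerivAt (fun y => rampPrim δ (ξ y)) (ramp δ (ξ x) • fderiv ℝ ξ x) x :=
      (hasDerivAt_rampPrim δ (ξ x)).comp_hasFDerivAt x
        (hξ.differentiable (by norm_num) x).hasFDerivAt
    rw [(h1.fun_mul ((hq d x hx).differentiableAt (by norm_num)).hasFDerivAt).fderiv]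
    simp only [add_apply, smul_apply, smul_eq_mul]
    ring
  obtain ⟨i1, z1⟩ := setIntegral_fderiv_apply_eq_zero hΩo hK hKΩ (hg ee1) (hz ee1) ee1
  obtain ⟨i2, z2⟩ := setIntegral_fderiv_apply_eq_zero hΩo hK hKΩ (hg ee2) (hz ee2) ee2
  have ione : IntegrableOn (fun _ : V2 => (1 : ℝ)) Ω :=
    integrableOn_of_continuousOn_closure hΩb continuousOn_const
  have hle : ∫ x in Ω, ramp δ (ξ x) * (gradSq ξ x / ρ x ^ 2)
      ≤ ∫ x in Ω, ((fderiv ℝ (fun y => rampPrim δ (ξ y) * (fderiv ℝ ξ y ee1 / ρ y ^ 2)) x ee1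
        + fderiv ℝ (fun y => rampPrim δ (ξ y) * (fderiv ℝ ξ y ee2 / ρ y ^ 2)) x ee2) + 1) := by
    refine setIntegral_mono_on ?_ ((i1.add i2).add ione) hΩo.measurableSet ?_
    · exact integrableOn_of_continuousOn_closure hΩb
        (((continuous_ramp δ).comp hξ.continuous).continuousOn.mul
          (continuousOn_gradSq_div hρ hpos hξ))
    · intro x hx
      rw [hder ee1 x hx, hder ee2 x hx]
      have hp := hpde x hx
      have e1 : pd1 (fun y => pd1 ξ y / ρ y ^ 2) x
        = fderiv ℝ (fun y => fderiv ℝ ξ y ee1 / ρ y ^ 2) x ee1 := rfl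
      have e2 : pd2 (fun y => pd2 ξ y / ρ y ^ 2) x
        = fderiv ℝ (fun y => fderiv ℝ ξ y ee2 / ρ y ^ 2) x ee2 := rfl
      rw [e1, e2] at hp
      have hs : fderiv ℝ (fun y => fderiv ℝ ξ y ee1 / ρ y ^ 2) x ee1
        + fderiv ℝ (fun y => fderiv ℝ ξ y ee2 / ρ y ^ 2) x ee2 = ξ x - 1 := by linarith
      have eg : gradSq ξ x / ρ x ^ 2
        = fderiv ℝ ξ x ee1 ^ 2 / ρ x ^ 2 + fderiv ℝ ξ x ee2 ^ 2 / ρ x ^ 2 := by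
        rw [← add_div]
        rfl
      have x0 := xi_pos hΩo hΩb hρ hpos hξ hpde h0 hx
      have x1 := xi_le_one hΩo hΩb hρ hpos hξ hpde h0 hx
      have p0 := rampPrim_nonneg (δ := δ) x0.le
      have p1 := rampPrim_le (δ := δ) x0.le
      have hprod : rampPrim δ (ξ x) * (1 - ξ x) ≤ 1 := by nlinarith
      rw [eg]
      nlinarith [congrArg (fun s => rampPrim δ (ξ x) * s) hs]
  refine hle.trans (le_of_eq ?_)
  have i12 : IntegrableOn (fun x =>
      fderiv ℝ (fun y => rampPrim δ (ξ y) * (fderiv ℝ ξ y ee1 / ρ y ^ 2)) x ee1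
        + fderiv ℝ (fun y => rampPrim δ (ξ y) * (fderiv ℝ ξ y ee2 / ρ y ^ 2)) x ee2) Ω := i1.add i2
  rw [integral_add i12 ione, integral_add i1 i2, z1, z2]
  simp

/-- Energy bound for the Meissner potential. -/
lemma setIntegral_gradSq_div_le {Ω : Set V2} (hΩo : IsOpen Ω) (hΩb : Bornology.IsBounded Ω)
    {ρ ξ : V2 → ℝ} (hρ : ContDiff ℝ 1 ρ) (hpos : ∀ x ∈ closure Ω, 0 < ρ x)
    (hξ : ContDiff ℝ 2 ξ) (hpde : XiPDE Ω ρ ξ) (h0 : ∀ x ∈ frontier Ω, ξ x = 0) :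
    ∫ x in Ω, gradSq ξ x / ρ x ^ 2 ≤ volume.real Ω := by
  have hcont := continuousOn_gradSq_div hρ hpos hξ
  have hg0 : ∀ x, 0 ≤ gradSq ξ x / ρ x ^ 2 := fun x => by
    unfold gradSq
    positivity
  have hlim : Filter.Tendsto
      (fun n : ℕ => ∫ x in Ω, ramp (1 / ((n : ℝ) + 1)) (ξ x) * (gradSq ξ x / ρ x ^ 2))
      Filter.atTop (nhds (∫ x in Ω, gradSq ξ x / ρ x ^ 2)) := by
    refine tendsto_integral_of_dominated_convergence (fun x => gradSq ξ x / ρ x ^ 2)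
      (fun n => ?_) (integrableOn_of_continuousOn_closure hΩb hcont) (fun n => ?_) ?_
    · exact (integrableOn_of_continuousOn_closure hΩb
        (((continuous_ramp _).comp hξ.continuous).continuousOn.mul hcont)).aestronglyMeasurable
    · refine Filter.Eventually.of_forall fun x => ?_
      rw [Real.norm_of_nonneg (mul_nonneg (ramp_nonneg _ _) (hg0 x))]
      exact mul_le_of_le_one_left (hg0 x) (ramp_le_one _ _)
    · refine (ae_restrict_iff' hΩo.measurableSet).2 (Filter.Eventually.of_forall fun x hx => ?_)
      have x0 := xi_pos hΩo hΩb hρ hpos hξ hpde h0 hx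
      have hev : ∀ᶠ n : ℕ in Filter.atTop, 1 / ((n : ℝ) + 1) < ξ x / 2 :=
        tendsto_one_div_add_atTop_nhds_zero_nat.eventually (gt_mem_nhds (by positivity))
      refine tendsto_const_nhds.congr' ?_
      filter_upwards [hev] with n hn
      rw [ramp_eq_one (by positivity) (by linarith), one_mul]
  exact le_of_tendsto hlim (Filter.Eventually.of_forall fun n =>
    setIntegral_ramp_mul_le hΩo hΩb hρ hpos hξ hpde h0 (by positivity))

lemma exists_contDiff_cutoff {K U : Set V2} (hK : IsCompact K) (hU : IsOpen U) (hKU : K ⊆ U) :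
    ∃ χ : V2 → ℝ, ContDiff ℝ 1 χ ∧ HasCompactSupport χ ∧ tsupport χ ⊆ U ∧ ∀ x ∈ K, χ x = 1 := by
  obtain ⟨L, hL, hKL, hLU⟩ := exists_compact_between hK hU hKU
  obtain ⟨χ, h0, h1, -⟩ := exists_contMDiffMap_zero_one_of_isClosed (n := 1)
    (modelWithCornersSelf ℝ V2) (isOpen_interior (s := L)).isClosed_compl hK.isClosed
    (Set.disjoint_left.2 fun x hx hx' => hx (hKL hx'))
  have hsupp : tsupport χ ⊆ L := by
    refine closure_minimal (fun x hx => ?_) hL.isClosed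
    by_contra hxL
    exact hx (h0 fun h => hxL (interior_subset h))
  exact ⟨χ, χ.contMDiff.contDiff, hL.of_isClosed_subset (isClosed_tsupport _) hsupp,
    hsupp.trans hLU, fun x hx => h1 hx⟩

/-- The weak Euler-Lagrange identity holds for test functions that are `C¹` near `closure Ω`. -/
lemma WeakEL.of_contDiffOn {Ω U : Set V2} (hΩo : IsOpen Ω) (hΩb : Bornology.IsBounded Ω)
    {a ρ g : V2 → ℝ} {ε : ℝ} (h : WeakEL Ω a ε ρ) (hU : IsOpen U) (hΩU : closure Ω ⊆ U)
    (hg : ContDiffOn ℝ 1 g U) :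
    ∫ x in Ω, (pd1 ρ x * pd1 g x + pd2 ρ x * pd2 g x)
      = (ε ^ 2)⁻¹ * ∫ x in Ω, ρ x * (a x - ρ x ^ 2) * g x := by
  obtain ⟨χ, hχ, hχc, hχU, hχ1⟩ := exists_contDiff_cutoff hΩb.isCompact_closure hU hΩU
  have hφ : ContDiff ℝ 1 (fun x => χ x * g x) := by
    refine contDiff_iff_contDiffAt.2 fun x => ?_
    by_cases hx : x ∈ tsupport χ
    · exact hχ.contDiffAt.mul (hg.contDiffAt (hU.mem_nhds (hχU hx)))
    · refine (contDiffAt_const (c := (0 : ℝ))).congr_of_eventuallyEq ?_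
      filter_upwards [notMem_tsupport_iff_eventuallyEq.1 hx] with y hy
      simp [hy]
  have hφc : HasCompactSupport (fun x => χ x * g x) := hχc.mul_right
  have h1 := h _ (ContDiff.lipschitzWith_of_hasCompactSupport hφc hφ (by norm_num))
  have hval : ∀ x ∈ Ω, χ x * g x = g x := fun x hx => by
    rw [hχ1 x (subset_closure hx), one_mul]
  have hder : ∀ x ∈ Ω, fderiv ℝ (fun x => χ x * g x) x = fderiv ℝ g x := by
    intro x hx
    refine Filter.EventuallyEq.fderiv_eq ?_
    filter_upwards [hΩo.mem_nhds hx] with z hz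
    exact hval z hz
  calc ∫ x in Ω, (pd1 ρ x * pd1 g x + pd2 ρ x * pd2 g x)
      = ∫ x in Ω, (pd1 ρ x * pd1 (fun y => χ y * g y) x
          + pd2 ρ x * pd2 (fun y => χ y * g y) x) :=
        setIntegral_congr_fun hΩo.measurableSet fun x hx => by simp only [pd1, pd2, hder x hx]
    _ = (ε ^ 2)⁻¹ * ∫ x in Ω, ρ x * (a x - ρ x ^ 2) * (χ x * g x) := h1
    _ = (ε ^ 2)⁻¹ * ∫ x in Ω, ρ x * (a x - ρ x ^ 2) * g x := by
        congr 1
        exact setIntegral_congr_fun hΩo.measurableSet fun x hx => by simp only [hval x hx]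

/-- Directional form of the energy decomposition for `U = ρ u`, with `g = ρ (|u|² - 1)`. -/
lemma sq_mul_norm_sq_cov_le {ρ g : V2 → ℝ} {u U : V2 → ℂ} {x : V2} (hρ : DifferentiableAt ℝ ρ x)
    (hu : DifferentiableAt ℝ u x) (hU : U = fun y => (ρ y : ℂ) * u y)
    (hg : g =ᶠ[nhds x] fun y => ρ y * (‖u y‖ ^ 2 - 1)) (d : V2) (β c : ℝ) :
    ρ x ^ 2 * ‖fderiv ℝ u x d - Complex.I * (β : ℂ) * u x‖ ^ 2
      ≤ 2 * (‖fderiv ℝ U x d - Complex.I * ((β + c : ℝ) : ℂ) * U x‖ ^ 2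
          - fderiv ℝ ρ x d * fderiv ℝ g x d - fderiv ℝ ρ x d ^ 2) + 2 * (c ^ 2 * ‖U x‖ ^ 2) := by
  have e1 : fderiv ℝ U x d = (fderiv ℝ ρ x d : ℂ) * u x + (ρ x : ℂ) * fderiv ℝ u x d := by
    have h1 : HasFDerivAt (fun y => (ρ y : ℂ)) (Complex.ofRealCLM.comp (fderiv ℝ ρ x)) x :=
      Complex.ofRealCLM.hasFDerivAt.comp x hρ.hasFDerivAt
    rw [hU, (h1.fun_mul hu.hasFDerivAt).fderiv]
    simp
    ring
  have e2 : fderiv ℝ g x d = fderiv ℝ ρ x d * (‖u x‖ ^ 2 - 1)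
      + ρ x * (2 * inner ℝ (u x) (fderiv ℝ u x d)) := by
    have hn : DifferentiableAt ℝ (fun y => ‖u y‖ ^ 2) x := hu.norm_sq ℝ
    rw [hg.fderiv_eq, (hρ.hasFDerivAt.fun_mul (hn.hasFDerivAt.sub_const 1)).fderiv]
    simp only [add_apply, smul_apply, smul_eq_mul]
    rw [fderiv_norm_sq_comp_apply hu]
    ring
  rw [e1, e2, hU]
  dsimp only
  generalize fderiv ℝ u x d = u1
  generalize fderiv ℝ ρ x d = p
  generalize u x = z
  generalize ρ x = r
  simp only [← Complex.normSq_eq_norm_sq]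
  simp only [Complex.inner, Complex.normSq_apply, Complex.mul_re, Complex.mul_im, Complex.sub_re,
    Complex.sub_im, Complex.add_re, Complex.add_im, Complex.conj_re, Complex.conj_im,
    Complex.I_re, Complex.I_im, Complex.ofReal_re, Complex.ofReal_im]
  have hp : 0 ≤ r ^ 2 * ((u1.re + β * z.im + 2 * c * z.im) ^ 2
      + (u1.im - β * z.re - 2 * c * z.re) ^ 2) := by positivity
  linarith

lemma curl2_add_smul {B m : V2 → V2} {x : V2} (hB : ∀ i, DifferentiableAt ℝ (fun y => B y i) x)
    (hm : ∀ i, DifferentiableAt ℝ (fun y => m y i) x) (h : ℝ) :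
    curl2 (fun y => B y + h • m y) x = curl2 B x + h * curl2 m x := by
  have e : ∀ i d, fderiv ℝ (fun y => (B y + h • m y) i) x d
      = fderiv ℝ (fun y => B y i) x d + h * fderiv ℝ (fun y => m y i) x d := by
    intro i d
    have h1 := (hB i).hasFDerivAt.fun_add ((hm i).hasFDerivAt.const_mul h)
    have h2 : (fun y => (B y + h • m y) i) = fun y => B y i + h * m y i := rfl
    rw [h2, h1.fderiv]
    simp
  simp only [curl2, pd1, pd2, e]
  ring

lemma differentiableAt_meissnerA0 {ρ ξ : V2 → ℝ} (hρ : ContDiff ℝ 1 ρ) (hξ : ContDiff ℝ 2 ξ)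
    {x : V2} (hx : ρ x ≠ 0) (i : Fin 2) :
    DifferentiableAt ℝ (fun y => meissnerA0 ρ ξ y i) x := by
  have hd : ∀ d, Differentiable ℝ (fun y => fderiv ℝ ξ y d) := fun d =>
    (contDiff_fderiv_apply (m := 1) hξ (by norm_num) d).differentiable (by norm_num)
  have hρ1 : DifferentiableAt ℝ (fun y => ρ y ^ 2) x :=
    (hρ.differentiable (by norm_num) x).fun_pow 2
  have h0 : ρ x ^ 2 ≠ 0 := pow_ne_zero 2 hx
  fin_cases i
  · simpa [meissnerA0, pd1, pd2, div_eq_mul_inv] using (hd ee2 x).fun_mul (hρ1.fun_inv h0)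
  · simpa [meissnerA0, pd1, pd2, div_eq_mul_inv] using (hd ee1 x).fun_neg.fun_mul (hρ1.fun_inv h0)

lemma curl2_meissnerA0 {Ω : Set V2} {ρ ξ : V2 → ℝ} (hpde : XiPDE Ω ρ ξ) {x : V2} (hx : x ∈ Ω) :
    curl2 (meissnerA0 ρ ξ) x = 1 - ξ x := by
  have h := hpde x hx
  have e : (fun y => meissnerA0 ρ ξ y 1) = fun y => -(pd1 ξ y / ρ y ^ 2) := by
    ext y
    simp [meissnerA0, neg_div]
  have e' : (fun y => meissnerA0 ρ ξ y 0) = fun y => pd2 ξ y / ρ y ^ 2 := by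
    ext y
    simp [meissnerA0]
  have e1 : pd1 (fun y => -(pd1 ξ y / ρ y ^ 2)) x = -pd1 (fun y => pd1 ξ y / ρ y ^ 2) x := by
    simp only [pd1, fderiv_fun_neg, neg_apply]
  rw [curl2, e, e', e1]
  linarith

lemma covGradSq_ofReal {ρ : V2 → ℝ} {B : V2 → V2} {x : V2} (hρ : DifferentiableAt ℝ ρ x) :
    covGradSq (fun y => (ρ y : ℂ)) B x = gradSq ρ x + ρ x ^ 2 * (B x 0 ^ 2 + B x 1 ^ 2) := by
  have e : ∀ d, fderiv ℝ (fun y => (ρ y : ℂ)) x d = (fderiv ℝ ρ x d : ℂ) := by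
    intro d
    have h1 : HasFDerivAt (fun y => (ρ y : ℂ)) (Complex.ofRealCLM.comp (fderiv ℝ ρ x)) x :=
      Complex.ofRealCLM.hasFDerivAt.comp x hρ.hasFDerivAt
    rw [h1.fderiv]
    rfl
  simp only [covGradSq, covD1, covD2, gradSq, pd1, pd2, e, ← Complex.normSq_eq_norm_sq,
    Complex.normSq_apply, Complex.mul_re, Complex.mul_im, Complex.sub_re, Complex.sub_im,
    Complex.I_re, Complex.I_im, Complex.ofReal_re, Complex.ofReal_im]
  ring

lemma continuous_covGradSq {u : V2 → ℂ} {A : V2 → V2} (hu : ContDiff ℝ 2 u)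
    (hA : ContDiff ℝ 2 A) : Continuous (covGradSq u A) := by
  have h1 : ∀ d, Continuous (fun y => fderiv ℝ u y d) := fun d =>
    (contDiff_fderiv_apply (m := 0) hu (by norm_num) d).continuous
  have h2 : ∀ i, Continuous (fun y => A y i) := fun i =>
    (differentiable_coord (hA.differentiable (by norm_num)) i).continuous
  have h3 : ∀ (d : V2) (i : Fin 2),
      Continuous (fun y => fderiv ℝ u y d - Complex.I * (A y i : ℂ) * u y) := fun d i =>
    (h1 d).sub ((continuous_const.mul (Complex.continuous_ofReal.comp (h2 i))).mul hu.continuous)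
  exact ((h3 ee1 0).norm.pow 2).add ((h3 ee2 1).norm.pow 2)

lemma continuous_curl2 {A : V2 → V2} (hA : ContDiff ℝ 2 A) : Continuous (curl2 A) := by
  have h : ∀ i, ContDiff ℝ 2 (fun y => A y i) := fun i =>
    (EuclideanSpace.proj i : V2 →L[ℝ] ℝ).contDiff.comp hA
  exact (contDiff_fderiv_apply (m := 0) (h 1) (by norm_num) ee1).continuous.sub
    (contDiff_fderiv_apply (m := 0) (h 0) (by norm_num) ee2).continuous

/-- the bound F_{ε,ρ}(u,A) ≤ C h_ex² for energy-minimizing critical points. -/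
theorem statement17
    (Ω : Set V2) (hΩo : IsOpen Ω) (hΩb : Bornology.IsBounded Ω)
    (hΩsc : SimplyConnectedSpace ↥Ω) (sb : SmoothBdry Ω)
    (b : ℝ) (hb : b ∈ Set.Ioo (0 : ℝ) 1) :
    ∃ C > 0, ∀ (ε hex : ℝ), ε ∈ Set.Ioc (0 : ℝ) 1 → 0 < hex → hex * ε ≤ 1 →
      ∀ (a : V2 → ℝ), ContinuousOn a (closure Ω) →
        (∀ x ∈ closure Ω, b ≤ a x ∧ a x ≤ 1) →
      ∀ (ρ : V2 → ℝ), ContDiff ℝ 1 ρ →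
        (∀ x ∈ closure Ω, Real.sqrt b ≤ ρ x ∧ ρ x ≤ 1) → WeakEL Ω a ε ρ →
      ∀ (ξ : V2 → ℝ), ContDiff ℝ 2 ξ → XiPDE Ω ρ ξ →
        (∀ x ∈ frontier Ω, ξ x = 0) →
      ∀ (u : V2 → ℂ) (A : V2 → V2) (uu : V2 → ℂ) (AA : V2 → V2),
        uu = (fun y => (ρ y : ℂ) * u y) →
        AA = (fun y => A y + hex • meissnerA0 ρ ξ y) →
        ContDiff ℝ 2 uu → ContDiff ℝ 2 AA →
        GLeq1 Ω a ε uu AA →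
        GLeq2 Ω uu AA →
        (∀ x ∈ frontier Ω, curl2 AA x = hex) →
        CovNeumann Ω sb uu AA →
        CoulombGauge Ω sb A →
        GLeps Ω a ε hex uu AA
          ≤ GLeps Ω a ε hex (fun y => (ρ y : ℂ)) (fun y => hex • meissnerA0 ρ ξ y) →
        Feps Ω ε ρ u A ≤ C * hex ^ 2 := by
  have hb0 : 0 < b := hb.1
  refine ⟨(3 + 1 / b) * volume.real Ω + 1, by positivity, ?_⟩
  intro ε hex hε hhex _ a ha hab ρ hρ hρb hEL ξ hξ hpde hξ0 u A uu AA huu hAA huu2 hAA2 hGL1 _ _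
    hN _ hmin
  have hε0 : 0 < ε := hε.1
  have hpos : ∀ x ∈ closure Ω, 0 < ρ x := fun x hx =>
    (Real.sqrt_pos.2 hb0).trans_le (hρb x hx).1
  have hρsq : ∀ x ∈ closure Ω, b ≤ ρ x ^ 2 := fun x hx => by
    rw [← Real.sq_sqrt hb0.le]
    exact pow_le_pow_left₀ (Real.sqrt_nonneg b) (hρb x hx).1 2
  have hmax := norm_sq_le_one hΩo hΩb sb hε0 (fun x hx => (hab x hx).2) huu2 hAA2 hGL1 hN
  have hρd : Differentiable ℝ ρ := hρ.differentiable (by norm_num)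
  -- the test function `g = ρ (|u|² - 1)`
  set U : Set V2 := {x | 0 < ρ x} with hUdef
  have hUo : IsOpen U := isOpen_lt continuous_const hρ.continuous
  set g : V2 → ℝ := fun y => ‖uu y‖ ^ 2 / ρ y - ρ y with hgdef
  have hg : ContDiffOn ℝ 1 g U := by
    intro x hx
    have hx' : 0 < ρ x := hx
    exact ((((huu2.norm_sq ℝ).of_le (by norm_num)).contDiffAt.div hρ.contDiffAt hx'.ne').sub
      hρ.contDiffAt).contDiffWithinAt
  have hweak := hEL.of_contDiffOn hΩo hΩb hUo (fun x hx => hpos x hx) hg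
  -- continuity and integrability
  have hcg : ContinuousOn g (closure Ω) := hg.continuousOn.mono fun x hx => hpos x hx
  have hcdg : ∀ d, ContinuousOn (fun x => fderiv ℝ g x d) (closure Ω) := fun d =>
    ((hg.continuousOn_fderiv_of_isOpen hUo (by norm_num)).clm_apply continuousOn_const).mono
      fun x hx => hpos x hx
  have hcdρ : ∀ d, Continuous (fun x => fderiv ℝ ρ x d) := fun d =>
    (contDiff_fderiv_apply (m := 0) hρ (by norm_num) d).continuous
  have hcuu : Continuous uu := huu2.continuous
  have hcρ : Continuous ρ := hρ.continuous
  have hcξ : Continuous ξ := hξ.continuous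
  have i1 : IntegrableOn (fun x => covGradSq uu AA x + (a x - ‖uu x‖ ^ 2) ^ 2 / (2 * ε ^ 2)
      + (curl2 AA x - hex) ^ 2) Ω := by
    refine integrableOn_of_continuousOn_closure hΩb ?_
    exact ((continuous_covGradSq huu2 hAA2).continuousOn.add
      (((ha.sub (hcuu.norm.pow 2).continuousOn).pow 2).div_const _)).add
      (((continuous_curl2 hAA2).sub continuous_const).pow 2).continuousOn
  have iq : IntegrableOn (fun x => gradSq ξ x / ρ x ^ 2) Ω :=
    integrableOn_of_continuousOn_closure hΩb (continuousOn_gradSq_div hρ hpos hξ)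
  have iξ : IntegrableOn (fun x => ξ x ^ 2) Ω :=
    integrableOn_of_continuousOn_closure hΩb (hcξ.pow 2).continuousOn
  have hqA : ∀ x ∈ Ω, meissnerA0 ρ ξ x 0 ^ 2 + meissnerA0 ρ ξ x 1 ^ 2
      = gradSq ξ x / ρ x ^ 2 / ρ x ^ 2 := by
    intro x hx
    have := (hpos x (subset_closure hx)).ne'
    simp only [meissnerA0, mkV_zero, mkV_one, gradSq]
    field_simp
    ring
  have he2 : ∀ x ∈ Ω, covGradSq (fun y => (ρ y : ℂ)) (fun y => hex • meissnerA0 ρ ξ y) x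
      + (a x - ‖(ρ x : ℂ)‖ ^ 2) ^ 2 / (2 * ε ^ 2)
      + (curl2 (fun y => hex • meissnerA0 ρ ξ y) x - hex) ^ 2
      = gradSq ρ x + hex ^ 2 * (gradSq ξ x / ρ x ^ 2) + (a x - ρ x ^ 2) ^ 2 / (2 * ε ^ 2)
        + hex ^ 2 * ξ x ^ 2 := by
    intro x hx
    have hx0 := (hpos x (subset_closure hx)).ne'
    have hcurl : curl2 (fun y => hex • meissnerA0 ρ ξ y) x = hex * (1 - ξ x) := by
      have h1 := curl2_add_smul (B := fun _ => (0 : V2)) (x := x)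
        (fun i => differentiableAt_const _) (differentiableAt_meissnerA0 hρ hξ hx0) hex
      rw [curl2_meissnerA0 hpde hx] at h1
      simpa [curl2, pd1, pd2] using h1
    have hA0 : ρ x ^ 2 * ((hex • meissnerA0 ρ ξ x) 0 ^ 2 + (hex • meissnerA0 ρ ξ x) 1 ^ 2)
        = hex ^ 2 * (gradSq ξ x / ρ x ^ 2) := by
      have h1 := hqA x hx
      have h2 : ρ x ^ 2 * (gradSq ξ x / ρ x ^ 2 / ρ x ^ 2) = gradSq ξ x / ρ x ^ 2 := by
        field_simp
      simp only [PiLp.smul_apply, smul_eq_mul]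
      calc _ = hex ^ 2 * (ρ x ^ 2 * (meissnerA0 ρ ξ x 0 ^ 2 + meissnerA0 ρ ξ x 1 ^ 2)) := by ring
        _ = _ := by rw [h1, h2]
    rw [covGradSq_ofReal (hρd x), hcurl, hA0, Complex.norm_real, Real.norm_eq_abs, sq_abs]
    ring
  have i2 : IntegrableOn (fun x => covGradSq (fun y => (ρ y : ℂ))
      (fun y => hex • meissnerA0 ρ ξ y) x + (a x - ‖(ρ x : ℂ)‖ ^ 2) ^ 2 / (2 * ε ^ 2)
      + (curl2 (fun y => hex • meissnerA0 ρ ξ y) x - hex) ^ 2) Ω := by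
    refine IntegrableOn.congr_fun ?_ (fun x hx => (he2 x hx).symm) hΩo.measurableSet
    refine integrableOn_of_continuousOn_closure hΩb ?_
    exact (((((hcdρ ee1).pow 2).add ((hcdρ ee2).pow 2)).continuousOn.add
      (continuousOn_const.mul (continuousOn_gradSq_div hρ hpos hξ))).add
      (((ha.sub (hcρ.pow 2).continuousOn).pow 2).div_const _)).add
      (continuous_const.mul (hcξ.pow 2)).continuousOn
  have i3 : IntegrableOn (fun x => pd1 ρ x * pd1 g x + pd2 ρ x * pd2 g x) Ω :=
    integrableOn_of_continuousOn_closure hΩb (((hcdρ ee1).continuousOn.mul (hcdg ee1)).add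
      ((hcdρ ee2).continuousOn.mul (hcdg ee2)))
  have i4 : IntegrableOn (fun x => ρ x * (a x - ρ x ^ 2) * g x) Ω :=
    integrableOn_of_continuousOn_closure hΩb ((hcρ.continuousOn.mul
      (ha.sub (hcρ.pow 2).continuousOn)).mul hcg)
  -- pointwise bound of the free energy density
  have hpt : ∀ x ∈ Ω, ρ x ^ 2 * covGradSq u A x + ρ x ^ 4 * (1 - ‖u x‖ ^ 2) ^ 2 / (2 * ε ^ 2)
      + curl2 A x ^ 2
      ≤ 2 * ((covGradSq uu AA x + (a x - ‖uu x‖ ^ 2) ^ 2 / (2 * ε ^ 2) + (curl2 AA x - hex) ^ 2)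
          - (covGradSq (fun y => (ρ y : ℂ)) (fun y => hex • meissnerA0 ρ ξ y) x
            + (a x - ‖(ρ x : ℂ)‖ ^ 2) ^ 2 / (2 * ε ^ 2)
            + (curl2 (fun y => hex • meissnerA0 ρ ξ y) x - hex) ^ 2))
        + (2 * ((ε ^ 2)⁻¹ * (ρ x * (a x - ρ x ^ 2) * g x)
            - (pd1 ρ x * pd1 g x + pd2 ρ x * pd2 g x))
          + (2 * hex ^ 2 * (1 + 1 / b) * (gradSq ξ x / ρ x ^ 2) + 4 * hex ^ 2 * ξ x ^ 2)) := by
    intro x hx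
    rw [he2 x hx]
    have hxc := subset_closure hx
    have hx0 := hpos x hxc
    have hevpos : ∀ᶠ y in nhds x, 0 < ρ y := hUo.mem_nhds hx0
    have hgev : g =ᶠ[nhds x] fun y => ρ y * (‖u y‖ ^ 2 - 1) := by
      filter_upwards [hevpos] with y hy
      simp only [hgdef, huu, norm_mul, Complex.norm_real, Real.norm_eq_abs, mul_pow, sq_abs]
      field_simp
    have hud : DifferentiableAt ℝ u x := by
      have h1 : DifferentiableAt ℝ (fun y => (ρ y)⁻¹ • uu y) x :=
        ((hρd x).fun_inv hx0.ne').fun_smul (huu2.differentiable (by norm_num) x)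
      refine h1.congr_of_eventuallyEq ?_
      filter_upwards [hevpos] with y hy
      have hyc : (ρ y : ℂ) ≠ 0 := by exact_mod_cast hy.ne'
      rw [huu, Complex.real_smul]
      push_cast
      rw [inv_mul_cancel_left₀ hyc]
    have hAi : ∀ i, AA x i = A x i + hex * meissnerA0 ρ ξ x i := fun i => by
      rw [hAA]
      rfl
    have d1 := sq_mul_norm_sq_cov_le (hρd x) hud huu hgev ee1 (A x 0) (hex * meissnerA0 ρ ξ x 0)
    have d2 := sq_mul_norm_sq_cov_le (hρd x) hud huu hgev ee2 (A x 1) (hex * meissnerA0 ρ ξ x 1)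
    rw [← hAi] at d1 d2
    have hcov : ρ x ^ 2 * covGradSq u A x ≤ 2 * (covGradSq uu AA x
        - (pd1 ρ x * pd1 g x + pd2 ρ x * pd2 g x) - gradSq ρ x)
        + 2 * (hex ^ 2 * (meissnerA0 ρ ξ x 0 ^ 2 + meissnerA0 ρ ξ x 1 ^ 2) * ‖uu x‖ ^ 2) := by
      simp only [covGradSq, covD1, covD2, gradSq, pd1, pd2]
      linarith
    have hq0 : 0 ≤ gradSq ξ x / ρ x ^ 2 := by
      unfold gradSq
      positivity
    have hA0 : hex ^ 2 * (meissnerA0 ρ ξ x 0 ^ 2 + meissnerA0 ρ ξ x 1 ^ 2) * ‖uu x‖ ^ 2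
        ≤ hex ^ 2 * (1 / b * (gradSq ξ x / ρ x ^ 2)) := by
      rw [hqA x hx]
      have h1 : gradSq ξ x / ρ x ^ 2 / ρ x ^ 2 ≤ 1 / b * (gradSq ξ x / ρ x ^ 2) := by
        rw [one_div_mul_eq_div]
        exact div_le_div_of_nonneg_left hq0 hb0 (hρsq x hxc)
      have h2 : 0 ≤ hex ^ 2 * (gradSq ξ x / ρ x ^ 2 / ρ x ^ 2) := by positivity
      exact (mul_le_of_le_one_right h2 (hmax x hxc)).trans
        (mul_le_mul_of_nonneg_left h1 (sq_nonneg hex))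
    have hcurl : curl2 A x = (curl2 AA x - hex) + hex * ξ x := by
      have h1 := curl2_add_smul (B := AA) (x := x)
        (fun i => differentiable_coord (hAA2.differentiable (by norm_num)) i x)
        (differentiableAt_meissnerA0 hρ hξ hx0.ne') (-hex)
      have h2 : (fun y => AA y + -hex • meissnerA0 ρ ξ y) = A := by
        ext1 y
        rw [hAA]
        simp
      rw [h2, curl2_meissnerA0 hpde hx] at h1
      linarith
    have hcurl2 : curl2 A x ^ 2 ≤ 2 * (curl2 AA x - hex) ^ 2 + 2 * (hex ^ 2 * ξ x ^ 2) := by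
      rw [hcurl]
      linarith [sq_nonneg ((curl2 AA x - hex) - hex * ξ x)]
    have hsq : ‖uu x‖ ^ 2 = ρ x ^ 2 * ‖u x‖ ^ 2 := by
      simp only [huu, norm_mul, Complex.norm_real, Real.norm_eq_abs, mul_pow, sq_abs]
    have hpot : ρ x ^ 4 * (1 - ‖u x‖ ^ 2) ^ 2 / (2 * ε ^ 2)
        = (a x - ‖uu x‖ ^ 2) ^ 2 / (2 * ε ^ 2) - (a x - ρ x ^ 2) ^ 2 / (2 * ε ^ 2)
          + (ε ^ 2)⁻¹ * (ρ x * (a x - ρ x ^ 2) * g x) := by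
      rw [hgev.eq_of_nhds, hsq]
      field_simp
      ring
    have hpot0 : 0 ≤ ρ x ^ 4 * (1 - ‖u x‖ ^ 2) ^ 2 / (2 * ε ^ 2) := by positivity
    linarith
  -- integration
  have i12 := (i1.sub i2).const_mul 2
  have i43 := ((i4.const_mul (ε ^ 2)⁻¹).sub i3).const_mul 2
  have iqξ := (iq.const_mul (2 * hex ^ 2 * (1 + 1 / b))).add (iξ.const_mul (4 * hex ^ 2))
  have hF : ∫ x in Ω, (ρ x ^ 2 * covGradSq u A x
      + ρ x ^ 4 * (1 - ‖u x‖ ^ 2) ^ 2 / (2 * ε ^ 2) + curl2 A x ^ 2) ≤ _ :=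
    integral_mono_of_nonneg (Filter.Eventually.of_forall fun x => by
      simp only [covGradSq, Pi.zero_apply]
      positivity) (i12.add (i43.add iqξ))
      ((ae_restrict_iff' hΩo.measurableSet).2 (Filter.Eventually.of_forall hpt))
  have hsplit := integral_add i12 (i43.add iqξ)
  have hsplit' := integral_add i43 iqξ
  have hsplit'' := integral_add (iq.const_mul (2 * hex ^ 2 * (1 + 1 / b)))
    (iξ.const_mul (4 * hex ^ 2))
  have hs12 := integral_sub i1 i2
  have hs43 := integral_sub (i4.const_mul (ε ^ 2)⁻¹) i3
  simp only [Pi.add_apply, Pi.sub_apply, integral_const_mul] at hF hsplit hsplit' hsplit'' hs12 hs43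
  rw [hsplit, hsplit', hsplit'', hs12, hs43, hweak, sub_self, mul_zero, zero_add] at hF
  have hQ := setIntegral_gradSq_div_le hΩo hΩb hρ hpos hξ hpde hξ0
  have hX : ∫ x in Ω, ξ x ^ 2 ≤ volume.real Ω := by
    have h1 : ∫ x in Ω, ξ x ^ 2 ≤ ∫ _ in Ω, (1 : ℝ) := by
      refine setIntegral_mono_on iξ
        (integrableOn_of_continuousOn_closure hΩb continuousOn_const) hΩo.measurableSet ?_
      intro x hx
      exact pow_le_one₀ (xi_pos hΩo hΩb hρ hpos hξ hpde hξ0 hx).le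
        (xi_le_one hΩo hΩb hρ hpos hξ hpde hξ0 hx)
    simpa using h1
  have hQ' := mul_le_mul_of_nonneg_left hQ
    (show 0 ≤ 2 * hex ^ 2 * (1 + 1 / b) by positivity)
  have hX' := mul_le_mul_of_nonneg_left hX (show 0 ≤ 4 * hex ^ 2 by positivity)
  unfold GLeps at hmin
  unfold Feps
  have hh := sq_nonneg hex
  linarith
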